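/- arXiv:2312.05400 — 3 statements merged into one kernel-verified Lean document; each statement's English description precedes it below -/
import Mathlib

section
/- Suppose g₁ is a version of E[Y₁(0) | W₀, A=1], μ₁ a version of E[Y₁ | W₀, A=0], g₀ a version of E[Y₀ | W₋₁, A=1], and μ₀ a version of E[Y₀ | W₋₁, A=0], and the stable bias assumption holds. Then the mean counterfactual outcome of the treated under no treatment satisfies the generalized difference-in-differences imputation identity E[Y₁(0) | A=1] = E[Y₀ + Δ*(W₀, W₋₁) | A=1], where Δ*(W₀, W₋₁) = μ₁(W₀) − μ₀(W₋₁). -/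
open MeasureTheory

/-- `f` is a version of the conditional expectation `E[Z | W, Ev]`:
it is measurable, `f ∘ W` is integrable, and for every measurable `S`,
`E[Z · 1_Ev · 1_{W ∈ S}] = E[f(W) · 1_Ev · 1_{W ∈ S}]`. -/
def IsCondexpVersion {Ω 𝒲 : Type*} [MeasurableSpace Ω] [MeasurableSpace 𝒲]
    (μ : Measure Ω) (Z : Ω → ℝ) (W : Ω → 𝒲) (Ev : Set Ω) (f : 𝒲 → ℝ) : Prop :=
  Measurable f ∧ Integrable (fun ω => f (W ω)) μ ∧
    ∀ S : Set 𝒲, MeasurableSet S →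
      ∫ ω in Ev ∩ W ⁻¹' S, Z ω ∂μ = ∫ ω in Ev ∩ W ⁻¹' S, f (W ω) ∂μ

/-- `p` is a version of the propensity score `P(A = 1 | W)`: it is measurable with
values in `[0,1]`, and `E[A · 1_{W ∈ S}] = E[p(W) · 1_{W ∈ S}]` for every measurable `S`. -/
def IsPropensityVersion {Ω 𝒲 : Type*} [MeasurableSpace Ω] [MeasurableSpace 𝒲]
    (μ : Measure Ω) (A : Ω → ℝ) (W : Ω → 𝒲) (p : 𝒲 → ℝ) : Prop :=
  Measurable p ∧ (∀ w, p w ∈ Set.Icc (0 : ℝ) 1) ∧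
    ∀ S : Set 𝒲, MeasurableSet S →
      ∫ ω in W ⁻¹' S, A ω ∂μ = ∫ ω in W ⁻¹' S, p (W ω) ∂μ

/-- Conditional expectation given an event: `E[Z | E] = E[Z · 1_E] / P(E)`. -/
noncomputable def cE {Ω : Type*} [MeasurableSpace Ω]
    (μ : Measure Ω) (Z : Ω → ℝ) (E : Set Ω) : ℝ :=
  (∫ ω in E, Z ω ∂μ) / (μ E).toReal

theorem IsCondexpVersion.setIntegral_eq {Ω 𝒲 : Type*} [MeasurableSpace Ω] [MeasurableSpace 𝒲]
    {μ : Measure Ω} {Z : Ω → ℝ} {W : Ω → 𝒲} {Ev : Set Ω} {f : 𝒲 → ℝ}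
    (h : IsCondexpVersion μ Z W Ev f) :
    ∫ ω in Ev, Z ω ∂μ = ∫ ω in Ev, f (W ω) ∂μ := by
  simpa using h.2.2 Set.univ MeasurableSet.univ

/-- Under the stable bias assumption, the generalized difference-in-differences imputation
function `Y₀ + Δ*(W₀, W₋₁)` with `Δ*(W₀, W₋₁) = μ₁(W₀) − μ₀(W₋₁)` correctly imputes the
mean counterfactual outcome of the treated: `E[Y₁(0) | A=1] = E[Y₀ + Δ*(W₀,W₋₁) | A=1]`. -/
theorem gdid_imputation
    {Ω 𝒲₀ 𝒲' : Type*} [MeasurableSpace Ω] [MeasurableSpace 𝒲₀] [MeasurableSpace 𝒲']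
    (μ : Measure Ω) [IsProbabilityMeasure μ]
    (A Y1 Y0 Y1c0 : Ω → ℝ) (W0 : Ω → 𝒲₀) (Wm1 : Ω → 𝒲')
    (hA : Measurable A) (hAbin : ∀ ω, A ω = 0 ∨ A ω = 1)
    (hW0 : Measurable W0) (hWm1 : Measurable Wm1)
    (hY1 : Integrable Y1 μ) (hY0 : Integrable Y0 μ) (hY1c0 : Integrable Y1c0 μ)
    (hpos : 0 < μ {ω | A ω = 1}) (hlt : μ {ω | A ω = 1} < 1)
    (g1 m1 : 𝒲₀ → ℝ) (g0 m0 : 𝒲' → ℝ)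
    (hg1 : IsCondexpVersion μ Y1c0 W0 {ω | A ω = 1} g1)
    (hm1 : IsCondexpVersion μ Y1 W0 {ω | A ω = 0} m1)
    (hg0 : IsCondexpVersion μ Y0 Wm1 {ω | A ω = 1} g0)
    (hm0 : IsCondexpVersion μ Y0 Wm1 {ω | A ω = 0} m0)
    (hstable : cE μ (fun ω => g1 (W0 ω) - m1 (W0 ω)) {ω | A ω = 1}
             = cE μ (fun ω => g0 (Wm1 ω) - m0 (Wm1 ω)) {ω | A ω = 1}) :
    cE μ Y1c0 {ω | A ω = 1}
      = cE μ (fun ω => Y0 ω + (m1 (W0 ω) - m0 (Wm1 ω))) {ω | A ω = 1} := by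
  have hE : (μ {ω | A ω = 1}).toReal ≠ 0 :=
    (ENNReal.toReal_pos hpos.ne' (measure_ne_top _ _)).ne'
  have h1 := hg1.setIntegral_eq
  have h0 := hg0.setIntegral_eq
  unfold cE at hstable ⊢
  rw [div_left_inj' hE] at hstable ⊢
  rw [integral_sub hg1.2.1.integrableOn hm1.2.1.integrableOn,
    integral_sub hg0.2.1.integrableOn hm0.2.1.integrableOn] at hstable
  have hsub : Integrable (fun ω => m1 (W0 ω) - m0 (Wm1 ω)) μ := hm1.2.1.sub hm0.2.1
  rw [integral_add hY0.integrableOn hsub.integrableOn,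
    integral_sub hm1.2.1.integrableOn hm0.2.1.integrableOn]
  linarith
end

section
/- (Double robustness of the ignorability moment functional.) Let μ₁ be a version of E[Y₁ | W₀, A=0] with μ₁(W₀) integrable, and let π be a version of P(A=1 | W₀) with π(W₀) ≤ 1−ε almost surely for some ε > 0. Then both of the following hold: (i) for every measurable π̃ : 𝒲₀ → [0, 1−ε] (a possibly misspecified propensity score) one has E[ ((1−A)·π̃(W₀)·Y₁ + (A − π̃(W₀))·μ₁(W₀)) / (1 − π̃(W₀)) ] = E[A·μ₁(W₀)]; and (ii) for every bounded measurable μ̃ : 𝒲₀ → ℝ (a possibly misspecified outcome regression) one has E[ ((1−A)·π(W₀)·Y₁ + (A − π(W₀))·μ̃(W₀)) / (1 − π(W₀)) ] = E[A·μ₁(W₀)]. In either case the resulting functional P(A=1)^{-1}·E[A·Y₁ − ((1−A)·p·Y₁ + (A−p)·m)/(1−p)] equals τ^ign = E[Y₁ | A=1] − E[μ₁(W₀) | A=1] provided at least one of the two nuisance functions is correctly specified. -/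
open MeasureTheory

/-- If `Z` integrates to zero over every event `W ∈ S`, it is orthogonal to every function of `W`. -/
theorem integral_comp_mul_eq_zero {Ω 𝒲 : Type*} [MeasurableSpace Ω] [MeasurableSpace 𝒲]
    {μ : Measure Ω} [IsFiniteMeasure μ] {Z : Ω → ℝ} {W : Ω → 𝒲} (hW : Measurable W)
    (hZ : Integrable Z μ) (hZ0 : ∀ S, MeasurableSet S → ∫ ω in W ⁻¹' S, Z ω ∂μ = 0)
    {g : 𝒲 → ℝ} (hg : Measurable g) (hgZ : Integrable (fun ω => g (W ω) * Z ω) μ) :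
    ∫ ω, g (W ω) * Z ω ∂μ = 0 := by
  have hm := hW.comap_le
  have hcond : (fun _ => (0 : ℝ)) =ᵐ[μ] μ[Z|MeasurableSpace.comap W inferInstance] := by
    refine ae_eq_condExp_of_forall_setIntegral_eq hm hZ
      (fun _ _ _ => integrableOn_zero) ?_ aestronglyMeasurable_const
    rintro _ ⟨S, hS, rfl⟩ -
    simp [hZ0 S hS]
  have hgW : StronglyMeasurable[MeasurableSpace.comap W inferInstance] (fun ω => g (W ω)) :=
    (hg.comp (comap_measurable W)).stronglyMeasurable
  have hpull := condExp_mul_of_stronglyMeasurable_left hgW hgZ hZ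
  calc ∫ ω, g (W ω) * Z ω ∂μ
      = ∫ ω, (μ[(fun ω => g (W ω)) * Z|MeasurableSpace.comap W inferInstance]) ω ∂μ :=
        (integral_condExp hm).symm
    _ = ∫ _, (0 : ℝ) ∂μ := by
        refine integral_congr_ae ?_
        filter_upwards [hpull, hcond] with ω h₁ h₂
        rw [h₁, Pi.mul_apply, ← h₂, mul_zero]
    _ = 0 := integral_zero _ _

theorem setIntegral_eq_integral_mul_of_binary {Ω : Type*} [MeasurableSpace Ω] {μ : Measure Ω}
    {A : Ω → ℝ} (hA : Measurable A) (hAbin : ∀ ω, A ω = 0 ∨ A ω = 1) (Z : Ω → ℝ) :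
    ∫ ω in {ω | A ω = 1}, Z ω ∂μ = ∫ ω, A ω * Z ω ∂μ := by
  have hA1 : MeasurableSet {ω | A ω = 1} := hA (measurableSet_singleton 1)
  rw [← integral_indicator hA1]
  congr 1 with ω
  rcases hAbin ω with h | h <;> simp [Set.indicator, h]

theorem integrable_binary_mul {Ω : Type*} [MeasurableSpace Ω] {μ : Measure Ω}
    {A Z : Ω → ℝ} (hA : Measurable A) (hAbin : ∀ ω, A ω = 0 ∨ A ω = 1) (hZ : Integrable Z μ) :
    Integrable (fun ω => A ω * Z ω) μ := by
  refine hZ.bdd_mul (c := 1) hA.aestronglyMeasurable (ae_of_all _ fun ω => ?_)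
  rcases hAbin ω with h | h <;> simp [h]

/-- The residual of the outcome regression in the control arm integrates to zero over every
event `W ∈ S`. -/
theorem IsCondexpVersion.setIntegral_residual_eq_zero {Ω 𝒲 : Type*} [MeasurableSpace Ω]
    [MeasurableSpace 𝒲] {μ : Measure Ω} {A Y : Ω → ℝ} {W : Ω → 𝒲} {f : 𝒲 → ℝ}
    (hf : IsCondexpVersion μ Y W {ω | A ω = 0} f)
    (hA : Measurable A) (hAbin : ∀ ω, A ω = 0 ∨ A ω = 1)
    (hY : Integrable Y μ) {S : Set 𝒲} (hS : MeasurableSet S) :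
    ∫ ω in W ⁻¹' S, (1 - A ω) * (Y ω - f (W ω)) ∂μ = 0 := by
  have hA0 : MeasurableSet {ω | A ω = 0} := hA (measurableSet_singleton 0)
  have hind : (fun ω => (1 - A ω) * (Y ω - f (W ω)))
      = {ω | A ω = 0}.indicator (fun ω => Y ω - f (W ω)) := by
    ext ω
    rcases hAbin ω with h | h <;> simp [Set.indicator, h]
  rw [hind, integral_indicator hA0, Measure.restrict_restrict hA0,
    integral_sub hY.integrableOn hf.2.1.integrableOn, hf.2.2 S hS, sub_self]

/-- The AIPW moment has mean `E[A·f(W)]` as soon as the product of the errors of the outcome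
regression `m` and the propensity score `p` has a vanishing weighted mean. -/
theorem IsCondexpVersion.integral_aipw {Ω 𝒲 : Type*} [MeasurableSpace Ω] [MeasurableSpace 𝒲]
    {μ : Measure Ω} [IsFiniteMeasure μ] {A Y : Ω → ℝ} {W : Ω → 𝒲} {f : 𝒲 → ℝ}
    (hf : IsCondexpVersion μ Y W {ω | A ω = 0} f)
    (hA : Measurable A) (hAbin : ∀ ω, A ω = 0 ∨ A ω = 1) (hW : Measurable W)
    (hY : Integrable Y μ) {ε : ℝ} (hε : 0 < ε) {p m : 𝒲 → ℝ} (hp : Measurable p)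
    (hp01 : ∀ᵐ ω ∂μ, p (W ω) ∈ Set.Icc 0 (1 - ε))
    (hint : Integrable (fun ω => (m (W ω) - f (W ω)) / (1 - p (W ω)) * (A ω - p (W ω))) μ)
    (hzero : ∫ ω, (m (W ω) - f (W ω)) / (1 - p (W ω)) * (A ω - p (W ω)) ∂μ = 0) :
    Integrable (fun ω => ((1 - A ω) * p (W ω) * Y ω + (A ω - p (W ω)) * m (W ω))
        / (1 - p (W ω))) μ ∧
      ∫ ω, ((1 - A ω) * p (W ω) * Y ω + (A ω - p (W ω)) * m (W ω)) / (1 - p (W ω)) ∂μ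
        = ∫ ω, A ω * f (W ω) ∂μ := by
  have hAf : Integrable (fun ω => A ω * f (W ω)) μ := integrable_binary_mul hA hAbin hf.2.1
  have hres : Integrable (fun ω => (1 - A ω) * (Y ω - f (W ω))) μ :=
    integrable_binary_mul (measurable_const.sub hA)
      (fun ω => by rcases hAbin ω with h | h <;> simp [h]) (hY.sub hf.2.1)
  have hodds : Measurable fun w => p w / (1 - p w) := hp.div (measurable_const.sub hp)
  have hwres : Integrable
      (fun ω => p (W ω) / (1 - p (W ω)) * ((1 - A ω) * (Y ω - f (W ω)))) μ := by
    refine hres.bdd_mul (c := 1 / ε) (hodds.comp hW).aestronglyMeasurable ?_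
    filter_upwards [hp01] with ω ⟨h0, h1⟩
    rw [Real.norm_of_nonneg (div_nonneg h0 (by linarith))]
    exact div_le_div₀ zero_le_one (by linarith) hε (by linarith)
  have hwres0 := integral_comp_mul_eq_zero hW hres
    (fun S hS => hf.setIntegral_residual_eq_zero hA hAbin hY hS) hodds hwres
  have hdecomp : (fun ω => A ω * f (W ω)
        + p (W ω) / (1 - p (W ω)) * ((1 - A ω) * (Y ω - f (W ω)))
        + (m (W ω) - f (W ω)) / (1 - p (W ω)) * (A ω - p (W ω))) =ᵐ[μ]
      fun ω => ((1 - A ω) * p (W ω) * Y ω + (A ω - p (W ω)) * m (W ω)) / (1 - p (W ω)) := by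
    filter_upwards [hp01] with ω ⟨_, h1⟩
    have hne : 1 - p (W ω) ≠ 0 := by linarith
    field_simp
    ring
  refine ⟨((hAf.add hwres).add hint).congr hdecomp, ?_⟩
  rw [← integral_congr_ae hdecomp, integral_add (by exact hAf.add hwres) hint,
    integral_add hAf hwres, hwres0, hzero, add_zero, add_zero]

/-- Double robustness of the ignorability moment functional: the AIPW moment recovers
`E[A·m1(W₀)]` (and hence `τ^ign`) when either the propensity score or the outcome
regression is possibly misspecified, as long as the other is correct. -/
theorem double_robustness_aipw
    {Ω 𝒲₀ : Type*} [MeasurableSpace Ω] [MeasurableSpace 𝒲₀]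
    (μ : Measure Ω) [IsProbabilityMeasure μ]
    (A Y1 : Ω → ℝ) (W0 : Ω → 𝒲₀)
    (hA : Measurable A) (hAbin : ∀ ω, A ω = 0 ∨ A ω = 1)
    (hW0 : Measurable W0) (hY1 : Integrable Y1 μ)
    (hpos : 0 < μ {ω | A ω = 1}) (hlt : μ {ω | A ω = 1} < 1)
    (ε : ℝ) (hε : 0 < ε)
    (m1 : 𝒲₀ → ℝ) (hm1 : IsCondexpVersion μ Y1 W0 {ω | A ω = 0} m1)
    (π : 𝒲₀ → ℝ) (hπ : IsPropensityVersion μ A W0 π)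
    (hπε : ∀ᵐ ω ∂μ, π (W0 ω) ≤ 1 - ε) :
    (∀ πt : 𝒲₀ → ℝ, Measurable πt → (∀ w, πt w ∈ Set.Icc (0 : ℝ) (1 - ε)) →
      ∫ ω, ((1 - A ω) * πt (W0 ω) * Y1 ω + (A ω - πt (W0 ω)) * m1 (W0 ω))
          / (1 - πt (W0 ω)) ∂μ
        = ∫ ω, A ω * m1 (W0 ω) ∂μ)
    ∧ (∀ mt : 𝒲₀ → ℝ, Measurable mt → (∃ C, ∀ w, |mt w| ≤ C) →
      ∫ ω, ((1 - A ω) * π (W0 ω) * Y1 ω + (A ω - π (W0 ω)) * mt (W0 ω))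
          / (1 - π (W0 ω)) ∂μ
        = ∫ ω, A ω * m1 (W0 ω) ∂μ)
    ∧ (∀ πt : 𝒲₀ → ℝ, Measurable πt → (∀ w, πt w ∈ Set.Icc (0 : ℝ) (1 - ε)) →
      (μ {ω | A ω = 1}).toReal⁻¹
          * ∫ ω, (A ω * Y1 ω
              - ((1 - A ω) * πt (W0 ω) * Y1 ω + (A ω - πt (W0 ω)) * m1 (W0 ω))
                  / (1 - πt (W0 ω))) ∂μ
        = cE μ Y1 {ω | A ω = 1} - cE μ (fun ω => m1 (W0 ω)) {ω | A ω = 1})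
    ∧ (∀ mt : 𝒲₀ → ℝ, Measurable mt → (∃ C, ∀ w, |mt w| ≤ C) →
      (μ {ω | A ω = 1}).toReal⁻¹
          * ∫ ω, (A ω * Y1 ω
              - ((1 - A ω) * π (W0 ω) * Y1 ω + (A ω - π (W0 ω)) * mt (W0 ω))
                  / (1 - π (W0 ω))) ∂μ
        = cE μ Y1 {ω | A ω = 1} - cE μ (fun ω => m1 (W0 ω)) {ω | A ω = 1}) := by
  have key₁ : ∀ πt : 𝒲₀ → ℝ, Measurable πt → (∀ w, πt w ∈ Set.Icc (0 : ℝ) (1 - ε)) → _ :=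
    fun πt hπt hπt01 => hm1.integral_aipw (m := m1) hA hAbin hW0 hY1 hε hπt
      (ae_of_all _ fun ω => hπt01 (W0 ω)) (by simp) (by simp)
  have key₂ : ∀ mt : 𝒲₀ → ℝ, Measurable mt → (∃ C, ∀ w, |mt w| ≤ C) →
      Integrable (fun ω => ((1 - A ω) * π (W0 ω) * Y1 ω + (A ω - π (W0 ω)) * mt (W0 ω))
          / (1 - π (W0 ω))) μ ∧
        ∫ ω, ((1 - A ω) * π (W0 ω) * Y1 ω + (A ω - π (W0 ω)) * mt (W0 ω))
          / (1 - π (W0 ω)) ∂μ = ∫ ω, A ω * m1 (W0 ω) ∂μ := by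
    rintro mt hmt ⟨C, hC⟩
    have hmtW : Integrable (fun ω => mt (W0 ω)) μ :=
      .of_bound (hmt.comp hW0).aestronglyMeasurable C (ae_of_all _ fun ω => hC (W0 ω))
    have hAint : Integrable A μ := by
      simpa using integrable_binary_mul hA hAbin (integrable_const (μ := μ) (1 : ℝ))
    have hπint : Integrable (fun ω => π (W0 ω)) μ :=
      .of_bound (hπ.1.comp hW0).aestronglyMeasurable 1 (ae_of_all _ fun ω => by
        rw [Real.norm_of_nonneg (hπ.2.1 _).1]; exact (hπ.2.1 _).2)
    have hweight : Measurable fun w => (mt w - m1 w) / (1 - π w) :=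
      (hmt.sub hm1.1).div (measurable_const.sub hπ.1)
    have hint : Integrable
        (fun ω => (mt (W0 ω) - m1 (W0 ω)) / (1 - π (W0 ω)) * (A ω - π (W0 ω))) μ := by
      refine ((hmtW.sub hm1.2.1).norm.const_mul (1 / ε)).mono'
        ((hweight.comp hW0).mul (hA.sub (hπ.1.comp hW0))).aestronglyMeasurable ?_
      filter_upwards [hπε] with ω h1
      obtain ⟨h0, h2⟩ := hπ.2.1 (W0 ω)
      have hden : |1 - π (W0 ω)| = 1 - π (W0 ω) := abs_of_pos (by linarith)
      have hres : |A ω - π (W0 ω)| ≤ 1 := by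
        rw [abs_le]
        rcases hAbin ω with h | h <;> rw [h] <;> constructor <;> linarith
      simp only [Real.norm_eq_abs, abs_mul, abs_div, hden, Pi.sub_apply]
      calc |mt (W0 ω) - m1 (W0 ω)| / (1 - π (W0 ω)) * |A ω - π (W0 ω)|
          ≤ |mt (W0 ω) - m1 (W0 ω)| / ε * 1 := by
            gcongr
            linarith
        _ = 1 / ε * |mt (W0 ω) - m1 (W0 ω)| := by ring
    refine hm1.integral_aipw (m := mt) hA hAbin hW0 hY1 hε hπ.1
      (hπε.mono fun ω h => ⟨(hπ.2.1 _).1, h⟩) hint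
      (integral_comp_mul_eq_zero hW0 (hAint.sub hπint) (fun S hS => ?_) hweight hint)
    simp only [Pi.sub_apply]
    rw [integral_sub hAint.integrableOn hπint.integrableOn, hπ.2.2 S hS, sub_self]
  have contrast : ∀ M : Ω → ℝ, Integrable M μ ∧ ∫ ω, M ω ∂μ = ∫ ω, A ω * m1 (W0 ω) ∂μ →
      (μ {ω | A ω = 1}).toReal⁻¹ * ∫ ω, (A ω * Y1 ω - M ω) ∂μ
        = cE μ Y1 {ω | A ω = 1} - cE μ (fun ω => m1 (W0 ω)) {ω | A ω = 1} := by
    rintro M ⟨hM, hMeq⟩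
    rw [integral_sub (integrable_binary_mul hA hAbin hY1) hM, hMeq, cE, cE,
      setIntegral_eq_integral_mul_of_binary hA hAbin,
      setIntegral_eq_integral_mul_of_binary hA hAbin]
    ring
  exact ⟨fun πt h h' => (key₁ πt h h').2, fun mt h h' => (key₂ mt h h').2,
    fun πt h h' => contrast _ (key₁ πt h h'), fun mt h h' => contrast _ (key₂ mt h h')⟩
end

section
/- (Identification of the group-time ATT under staggered adoption.) Let E₁ = {Ā_t = ā_t} (the event that the treatment history through time t equals ā_t) and E₀ = {Ā_t = 0_t} (the never-treated-through-t event) be disjoint events with P(E₁) > 0 and P(E₀) > 0, and write D = 1_{E₁}, D₀ = 1_{E₀}. Suppose consistency (Y_t = Y_t(ā_t) almost surely on E₁ and Y_t = Y_t(0_t) almost surely on E₀) and no anticipation (the pre-period outcome Y₀ is unaffected by treatment on E₁ ∪ E₀). Let μ_t be a version of E[Y_t | W_𝒫, E₀], g_t a version of E[Y_t(0_t) | W_𝒫, E₁], μ₀ a version of E[Y₀ | W_{𝒫−1}, E₀], and g₀ a version of E[Y₀ | W_{𝒫−1}, E₁], and suppose the staggered stable bias assumption holds: E[g_t(W_𝒫)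 − μ_t(W_𝒫) | E₁] = E[g₀(W_{𝒫−1}) − μ₀(W_{𝒫−1}) | E₁]. Then the group-time average treatment effect τ_{ā_t} = E[Y_t(ā_t) − Y_t(0_t) | E₁] is identified by τ_{ā_t} = E[Y_t | E₁] − E[μ_t(W_𝒫) | E₁] − E[Y₀ | E₁] + E[μ₀(W_{𝒫−1}) | E₁]. -/
open MeasureTheory

/-- Conditional expectation given an event is additive under differences. -/
theorem cE_sub {Ω : Type*} [MeasurableSpace Ω] {μ : Measure Ω} {X Y : Ω → ℝ} {E : Set Ω}
    (hX : Integrable X μ) (hY : Integrable Y μ) :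
    cE μ (fun ω => X ω - Y ω) E = cE μ X E - cE μ Y E := by
  simp only [cE, integral_sub hX.integrableOn hY.integrableOn, sub_div]

/-- Conditional expectation given `E` depends only on the almost sure values on `E`. -/
theorem cE_congr_ae {Ω : Type*} [MeasurableSpace Ω] {μ : Measure Ω} {X Y : Ω → ℝ} {E : Set Ω}
    (hE : MeasurableSet E) (h : ∀ᵐ ω ∂μ, ω ∈ E → X ω = Y ω) : cE μ X E = cE μ Y E := by
  simp only [cE, setIntegral_congr_ae hE h]

/-- The tower property for a version of `E[Z | W, Ev]`. -/
theorem IsCondexpVersion.cE_eq {Ω 𝒲 : Type*} [MeasurableSpace Ω] [MeasurableSpace 𝒲]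
    {μ : Measure Ω} {Z : Ω → ℝ} {W : Ω → 𝒲} {Ev : Set Ω} {f : 𝒲 → ℝ}
    (h : IsCondexpVersion μ Z W Ev f) : cE μ Z Ev = cE μ (fun ω => f (W ω)) Ev := by
  have := h.2.2 Set.univ MeasurableSet.univ
  simp only [Set.preimage_univ, Set.inter_univ] at this
  simp only [cE, this]

/-- Identification of the group-time ATT under staggered adoption: under consistency,
no anticipation, and the staggered stable bias assumption,
`τ_{ā_t} = E[Y_t(ā_t) − Y_t(0_t) | E₁]
  = E[Y_t | E₁] − E[μ_t(W_𝒫) | E₁] − E[Y₀ | E₁] + E[μ₀(W_{𝒫−1}) | E₁]`,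
where `E₁ = {Ā_t = ā_t}` and `E₀ = {Ā_t = 0_t}`. -/
theorem staggered_gdid_identification
    {Ω 𝒲 𝒲' : Type*} [MeasurableSpace Ω] [MeasurableSpace 𝒲] [MeasurableSpace 𝒲']
    (μ : Measure Ω) [IsProbabilityMeasure μ]
    (E1 E0 : Set Ω) (hE1meas : MeasurableSet E1) (hE0meas : MeasurableSet E0)
    (hdisj : Disjoint E1 E0) (hE1pos : 0 < μ E1) (hE0pos : 0 < μ E0)
    (Yt Y0 Ytbar Yt0 Y0bar Y00 : Ω → ℝ)
    (hYt : Integrable Yt μ) (hY0 : Integrable Y0 μ)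
    (hYtbar : Integrable Ytbar μ) (hYt0 : Integrable Yt0 μ)
    (WP : Ω → 𝒲) (WPm1 : Ω → 𝒲')
    (hWP : Measurable WP) (hWPm1 : Measurable WPm1)
    (hcons1 : ∀ᵐ ω ∂μ, ω ∈ E1 → Yt ω = Ytbar ω)
    (hcons0 : ∀ᵐ ω ∂μ, ω ∈ E0 → Yt ω = Yt0 ω)
    (hnoanticip : ∀ᵐ ω ∂μ, ω ∈ E1 ∪ E0 → Y0bar ω = Y0 ω ∧ Y00 ω = Y0 ω)
    (mt gt : 𝒲 → ℝ) (m0 g0 : 𝒲' → ℝ)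
    (hmt : IsCondexpVersion μ Yt WP E0 mt)
    (hgt : IsCondexpVersion μ Yt0 WP E1 gt)
    (hm0 : IsCondexpVersion μ Y0 WPm1 E0 m0)
    (hg0 : IsCondexpVersion μ Y0 WPm1 E1 g0)
    (hstable : cE μ (fun ω => gt (WP ω) - mt (WP ω)) E1
             = cE μ (fun ω => g0 (WPm1 ω) - m0 (WPm1 ω)) E1) :
    cE μ (fun ω => Ytbar ω - Yt0 ω) E1
      = cE μ Yt E1 - cE μ (fun ω => mt (WP ω)) E1
        - cE μ Y0 E1 + cE μ (fun ω => m0 (WPm1 ω)) E1 := by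
  rw [cE_sub hgt.2.1 hmt.2.1, cE_sub hg0.2.1 hm0.2.1,
    ← hgt.cE_eq, ← hg0.cE_eq] at hstable
  rw [cE_sub hYtbar hYt0, ← cE_congr_ae hE1meas hcons1]
  linarith
end
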